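/- arXiv:math/9911216 — 2 statements merged into one kernel-verified Lean document; each statement's English description precedes it below -/
import Mathlib

section
/- Let W be a separable unital C*-algebra. Then there exist a separable unital C*-algebra Z of real rank zero and a unital *-homomorphism p : W → Z which is RR₀-invertible: for every separable unital C*-algebra X of real rank zero and every unital *-homomorphism g : W → X there exists a unital *-homomorphism h : Z → X such that g = h ∘ p. -/
/-- A unital C*-algebra has real rank zero if every self-adjoint element can be
approximated arbitrarily closely by invertible self-adjoint elements. -/
def RealRankZero (X : Type*) [NormedRing X] [StarRing X] : Prop :=
  ∀ x : X, IsSelfAdjoint x → ∀ ε : ℝ, 0 < ε →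
    ∃ y : X, IsSelfAdjoint y ∧ IsUnit y ∧ ‖x - y‖ < ε

open scoped ENNReal

/-- In a C*-algebra of real rank zero, the approximating invertible self-adjoint element can be
chosen with a bound on the norm of its inverse depending only on the tolerance. -/
theorem RealRankZero.exists_norm_inverse_le {X : Type*} [CStarAlgebra X] (hX : RealRankZero X)
    {x : X} (hx : IsSelfAdjoint x) {δ : ℝ} (hδ : 0 < δ) :
    ∃ y z : X, IsSelfAdjoint y ∧ y * z = 1 ∧ z * y = 1 ∧ ‖x - y‖ ≤ 2 * δ ∧ ‖z‖ ≤ δ⁻¹ := by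
  obtain ⟨u, hu, hunit, hxu⟩ := hX x hx δ hδ
  have hne : ∀ t ∈ spectrum ℝ u, t ≠ 0 := fun t ht h0 =>
    spectrum.zero_notMem ℝ hunit (h0 ▸ ht)
  have habs : ∀ t : ℝ, t ≠ 0 → |t + δ * (t / |t|)| = |t| + δ := by
    intro t ht
    rcases lt_or_gt_of_ne ht with h | h
    · rw [abs_of_neg h, div_neg, div_self ht, abs_of_neg (by linarith)]
      ring
    · rw [abs_of_pos h, div_self ht, abs_of_pos (by linarith)]
      ring
  have hf0 : ∀ t ∈ spectrum ℝ u, t + δ * (t / |t|) ≠ 0 := by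
    intro t ht h
    have h1 := habs t (hne t ht)
    rw [h, abs_zero] at h1
    linarith [abs_nonneg t]
  have hf : ContinuousOn (fun t : ℝ => t + δ * (t / |t|)) (spectrum ℝ u) :=
    continuousOn_id.add (continuousOn_const.mul (continuousOn_id.div continuous_abs.continuousOn
      fun t ht => abs_ne_zero.mpr (hne t ht)))
  have hg : ContinuousOn (fun t : ℝ => (t + δ * (t / |t|))⁻¹) (spectrum ℝ u) := hf.inv₀ hf0
  refine ⟨cfc (fun t : ℝ => t + δ * (t / |t|)) u, cfc (fun t : ℝ => (t + δ * (t / |t|))⁻¹) u,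
    cfc_predicate _ _, ?_, ?_, ?_, ?_⟩
  · rw [← cfc_mul _ _ u hf hg, ← cfc_one ℝ u]
    exact cfc_congr fun t ht => mul_inv_cancel₀ (hf0 t ht)
  · rw [← cfc_mul _ _ u hg hf, ← cfc_one ℝ u]
    exact cfc_congr fun t ht => inv_mul_cancel₀ (hf0 t ht)
  · have huf : ‖u - cfc (fun t : ℝ => t + δ * (t / |t|)) u‖ ≤ δ := by
      nth_rewrite 1 [← cfc_id ℝ u]
      rw [← cfc_sub _ _ u continuousOn_id hf]
      refine norm_cfc_le hδ.le fun t ht => ?_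
      have h1 : |t| ≠ 0 := abs_ne_zero.mpr (hne t ht)
      simp [div_self h1, abs_of_pos hδ]
    calc ‖x - cfc (fun t : ℝ => t + δ * (t / |t|)) u‖
        ≤ ‖x - u‖ + ‖u - cfc (fun t : ℝ => t + δ * (t / |t|)) u‖ :=
          norm_sub_le_norm_sub_add_norm_sub _ _ _
      _ ≤ 2 * δ := by linarith
  · refine norm_cfc_le (inv_nonneg.mpr hδ.le) fun t ht => ?_
    rw [norm_inv, Real.norm_eq_abs, habs t (hne t ht)]
    exact inv_anti₀ hδ (by linarith [abs_nonneg t])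

/-- A countable set is contained in a countable set closed under countably many binary
operations. -/
theorem Set.Countable.exists_closed_under {α : Type*} {C : Set α} (hC : C.Countable)
    {ops : Set (α → α → α)} (hops : ops.Countable) :
    ∃ S : Set α, S.Countable ∧ C ⊆ S ∧ ∀ f ∈ ops, ∀ a ∈ S, ∀ b ∈ S, f a b ∈ S := by
  let step : Set α → Set α := fun T => T ∪ ⋃ f ∈ ops, Set.image2 f T T
  let T : ℕ → Set α := fun n => step^[n] C
  have hsucc : ∀ n, T (n + 1) = step (T n) := fun n => Function.iterate_succ_apply' step n C
  have hmono : Monotone T := monotone_nat_of_le_succ fun n => by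
    rw [hsucc]
    exact Set.subset_union_left
  have hcount : ∀ n, (T n).Countable := by
    intro n
    induction n with
    | zero => exact hC
    | succ n ih =>
      rw [hsucc]
      exact ih.union (hops.biUnion fun f _ => ih.image2 ih f)
  refine ⟨⋃ n, T n, Set.countable_iUnion hcount, Set.subset_iUnion T 0, ?_⟩
  intro f hf a ha b hb
  obtain ⟨m, hm⟩ := Set.mem_iUnion.mp ha
  obtain ⟨n, hn⟩ := Set.mem_iUnion.mp hb
  refine Set.mem_iUnion.mpr ⟨max m n + 1, ?_⟩
  rw [hsucc]
  exact Or.inr (Set.mem_biUnion hf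
    (Set.mem_image2_of_mem (hmono (le_max_left m n) hm) (hmono (le_max_right m n) hn)))

/-- In a C*-algebra of real rank zero, every countable set is contained in a separable closed
unital star subalgebra of real rank zero. -/
theorem RealRankZero.exists_separable_starSubalgebra {P : Type*} [CStarAlgebra P]
    (hP : RealRankZero P) {C : Set P} (hC : C.Countable) :
    ∃ Z : StarSubalgebra ℂ P, IsClosed (Z : Set P) ∧ C ⊆ Z ∧
      TopologicalSpace.SeparableSpace Z ∧ RealRankZero Z := by
  have key : ∀ (a : P) (n : ℕ), ∃ y z : P, IsSelfAdjoint y ∧ y * z = 1 ∧ z * y = 1 ∧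
      ‖((2⁻¹ : ℂ) • (a + star a)) - y‖ < 1 / ((n : ℝ) + 1) := by
    intro a n
    have hsa : IsSelfAdjoint ((2⁻¹ : ℂ) • (a + star a)) := by
      simp [IsSelfAdjoint, star_smul, add_comm]
    obtain ⟨y, hy, ⟨u, rfl⟩, hn⟩ := hP _ hsa (1 / ((n : ℝ) + 1)) (by positivity)
    exact ⟨u, ↑u⁻¹, hy, u.mul_inv, u.inv_mul, hn⟩
  choose F G hF hFG hGF hFn using key
  obtain ⟨Q, hQc, hQd⟩ := TopologicalSpace.exists_countable_dense ℂ
  let ops : Set (P → P → P) :=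
    {fun a b => a + b, fun a b => a * b, fun a _ => star a} ∪
      ((fun (q : ℂ) (a _ : P) => q • a) '' Q ∪
        (Set.range (fun (n : ℕ) (a _ : P) => F a n) ∪
          Set.range (fun (n : ℕ) (a _ : P) => G a n)))
  have hops : ops.Countable :=
    (Set.Finite.countable (by simp)).union ((hQc.image _).union
      ((Set.countable_range _).union (Set.countable_range _)))
  obtain ⟨S, hSc, hCS, hS⟩ := (hC.insert 1 |>.insert 0).exists_closed_under hops
  have hSadd : ∀ a ∈ S, ∀ b ∈ S, a + b ∈ S := hS _ (by simp [ops])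
  have hSmul : ∀ a ∈ S, ∀ b ∈ S, a * b ∈ S := hS _ (by simp [ops])
  have hSstar : ∀ a ∈ S, star a ∈ S := fun a ha =>
    hS (fun a _ => star a) (by simp [ops]) a ha a ha
  have hSsmul : ∀ q ∈ Q, ∀ a ∈ S, q • a ∈ S := fun q hq a ha =>
    hS (fun a _ => q • a) (Or.inr (Or.inl ⟨q, hq, rfl⟩)) a ha a ha
  have hSF : ∀ n, ∀ a ∈ S, F a n ∈ S := fun n a ha =>
    hS (fun a _ => F a n) (Or.inr (Or.inr (Or.inl ⟨n, rfl⟩))) a ha a ha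
  have hSG : ∀ n, ∀ a ∈ S, G a n ∈ S := fun n a ha =>
    hS (fun a _ => G a n) (Or.inr (Or.inr (Or.inr ⟨n, rfl⟩))) a ha a ha
  have hcsmul : ∀ (r : ℂ), ∀ a ∈ closure S, r • a ∈ closure S := fun r a ha =>
    map_mem_closure₂ continuous_smul (hQd r) ha hSsmul
  have h1 : (1 : P) ∈ closure S := subset_closure (hCS (by simp))
  let Z : StarSubalgebra ℂ P :=
    { carrier := closure S
      add_mem' := fun ha hb => map_mem_closure₂ continuous_add ha hb hSadd
      mul_mem' := fun ha hb => map_mem_closure₂ continuous_mul ha hb hSmul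
      zero_mem' := subset_closure (hCS (by simp))
      one_mem' := h1
      star_mem' := fun ha => map_mem_closure continuous_star ha hSstar
      algebraMap_mem' := fun r => by
        rw [Algebra.algebraMap_eq_smul_one]
        exact hcsmul r 1 h1 }
  have hSZ : S ⊆ Z := subset_closure
  refine ⟨Z, isClosed_closure, ?_, ?_, ?_⟩
  · exact fun c hc => hSZ (hCS (by simp [hc]))
  · exact (hSc.isSeparable.closure).separableSpace
  · rintro ⟨x, hxZ⟩ hx ε hε
    have hx' : star x = x := congrArg Subtype.val hx
    obtain ⟨s, hs, hxs⟩ := Metric.mem_closure_iff.mp hxZ (ε / 2) (by positivity)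
    rw [dist_eq_norm] at hxs
    obtain ⟨n, hn⟩ := exists_nat_one_div_lt (half_pos hε)
    refine ⟨⟨F s n, hSZ (hSF n s hs)⟩, Subtype.ext (hF s n), ?_, ?_⟩
    · exact ⟨⟨⟨F s n, hSZ (hSF n s hs)⟩, ⟨G s n, hSZ (hSG n s hs)⟩,
        Subtype.ext (hFG s n), Subtype.ext (hGF s n)⟩, rfl⟩
    · change ‖x - F s n‖ < ε
      have hre : x - (2⁻¹ : ℂ) • (s + star s) = (2⁻¹ : ℂ) • ((x - s) + star (x - s)) := by
        rw [star_sub, hx']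
        module
      have h2 : ‖x - (2⁻¹ : ℂ) • (s + star s)‖ ≤ ‖x - s‖ := by
        have h2inv : ‖(2⁻¹ : ℂ)‖ = 2⁻¹ := by simp
        rw [hre, norm_smul, h2inv]
        have h3 := norm_add_le (x - s) (star (x - s))
        rw [norm_star] at h3
        linarith
      calc ‖x - F s n‖
          ≤ ‖x - (2⁻¹ : ℂ) • (s + star s)‖ + ‖(2⁻¹ : ℂ) • (s + star s) - F s n‖ :=
            norm_sub_le_norm_sub_add_norm_sub _ _ _
        _ < ε := by linarith [hFn s n]

section Product

variable {I : Type*} {A : I → Type*} [∀ i, Nontrivial (A i)] [∀ i, CStarAlgebra (A i)]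

noncomputable instance lp.inftyCStarAlgebra : CStarAlgebra (lp A ∞) where

/-- The bounded product of C*-algebras of real rank zero has real rank zero. -/
theorem RealRankZero.lp_infty (hA : ∀ i, RealRankZero (A i)) : RealRankZero (lp A ∞) := by
  intro x hx ε hε
  have hxi : ∀ i, IsSelfAdjoint (x i) := fun i => congrArg (fun v : lp A ∞ => v i) hx
  choose y z hy hyz hzy hxy hz using fun i =>
    (hA i).exists_norm_inverse_le (hxi i) (show 0 < ε / 4 by positivity)
  have hd : Memℓp (fun i => x i - y i) ∞ := by
    refine memℓp_infty ⟨2 * (ε / 4), ?_⟩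
    rintro _ ⟨i, rfl⟩
    exact hxy i
  have hzm : Memℓp z ∞ := by
    refine memℓp_infty ⟨(ε / 4)⁻¹, ?_⟩
    rintro _ ⟨i, rfl⟩
    exact hz i
  let d : lp A ∞ := ⟨fun i => x i - y i, hd⟩
  let w : lp A ∞ := ⟨z, hzm⟩
  have hdi : ∀ i, (x - d) i = y i := fun i => sub_sub_cancel (x i) (y i)
  refine ⟨x - d, ?_, ⟨⟨x - d, w, ?_, ?_⟩, rfl⟩, ?_⟩
  · ext i
    change star ((x - d) i) = (x - d) i
    rw [hdi]
    exact hy i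
  · ext i
    change (x - d) i * z i = 1
    rw [hdi]
    exact hyz i
  · ext i
    change z i * (x - d) i = 1
    rw [hdi]
    exact hzy i
  · rw [sub_sub_cancel]
    refine (lp.norm_le_of_forall_le (C := 2 * (ε / 4)) (by positivity) hxy).trans_lt ?_
    linarith

/-- Evaluation at an index, as a unital star homomorphism on the bounded product. -/
def lp.inftyEval (A : I → Type*) [∀ i, Nontrivial (A i)] [∀ i, CStarAlgebra (A i)] (i : I) :
    lp A ∞ →⋆ₐ[ℂ] A i where
  toFun x := x i
  map_one' := rfl
  map_mul' _ _ := rfl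
  map_zero' := rfl
  map_add' _ _ := rfl
  commutes' _ := rfl
  map_star' _ := rfl

/-- A family of unital star homomorphisms into C*-algebras induces one into their bounded
product. -/
def lp.inftyLift {W : Type*} [CStarAlgebra W] (g : ∀ i, W →⋆ₐ[ℂ] A i) : W →⋆ₐ[ℂ] lp A ∞ where
  toFun w := ⟨fun i => g i w, memℓp_infty ⟨‖w‖, by
    rintro _ ⟨i, rfl⟩
    exact NonUnitalStarAlgHom.norm_apply_le (g i) w⟩⟩
  map_one' := by
    ext i
    exact map_one (g i)
  map_mul' a b := by
    ext i
    exact map_mul (g i) a b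
  map_zero' := by
    ext i
    exact map_zero (g i)
  map_add' a b := by
    ext i
    exact map_add (g i) a b
  commutes' r := by
    ext i
    exact AlgHomClass.commutes (g i) r
  map_star' a := by
    ext i
    exact map_star (g i) a

end Product

section Code

/-- The type of codes for C*-algebras under `W` with underlying set embedded in `K`: the graphs of
addition, multiplication, star, scalar multiplication and of the structure map. -/
abbrev CStarCode (W K : Type*) : Type _ :=
  Set (K × K × K) × Set (K × K × K) × Set (K × K) × Set (ℂ × K × K) × Set (W × K)

/-- The code of a homomorphism `g : W → X` relative to a map `e : X → K`. -/
def cstarCode {W X K : Type*} [CStarAlgebra W] [CStarAlgebra X] (g : W →⋆ₐ[ℂ] X) (e : X → K) :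
    CStarCode W K :=
  (Set.range fun a : X × X => (e a.1, e a.2, e (a.1 + a.2)),
    Set.range fun a : X × X => (e a.1, e a.2, e (a.1 * a.2)),
    Set.range fun a : X => (e a, e (star a)),
    Set.range fun a : ℂ × X => (a.1, e a.2, e (a.1 • a.2)),
    Set.range fun w : W => (w, e (g w)))

/-- Homomorphisms with the same code differ by a star homomorphism of their codomains. -/
theorem exists_comp_eq_of_cstarCode_eq {W X Y K : Type*} [CStarAlgebra W] [CStarAlgebra X]
    [CStarAlgebra Y] {g : W →⋆ₐ[ℂ] X} {g' : W →⋆ₐ[ℂ] Y} {e : X → K} {e' : Y → K}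
    (he' : Function.Injective e') (h : cstarCode g e = cstarCode g' e') :
    ∃ φ : X →⋆ₐ[ℂ] Y, g' = φ.comp g := by
  simp only [cstarCode, Prod.mk.injEq] at h
  obtain ⟨hadd, hmul, hstar, hsmul, hg⟩ := h
  have hex : ∀ x : X, ∃ y : Y, e' y = e x := by
    intro x
    have hx : (e x, e (star x)) ∈ Set.range fun a : Y => (e' a, e' (star a)) :=
      hstar ▸ Set.mem_range_self x
    obtain ⟨y, hy⟩ := hx
    exact ⟨y, congrArg Prod.fst hy⟩
  choose φ hφ using hex
  have φadd : ∀ a b, φ (a + b) = φ a + φ b := by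
    intro a b
    have hab : (e a, e b, e (a + b)) ∈
        Set.range fun a : Y × Y => (e' a.1, e' a.2, e' (a.1 + a.2)) :=
      hadd ▸ Set.mem_range_self (a, b)
    obtain ⟨⟨c, d⟩, hcd⟩ := hab
    simp only [Prod.mk.injEq, ← hφ] at hcd
    rw [← he' hcd.1, ← he' hcd.2.1, he' hcd.2.2]
  have φmul : ∀ a b, φ (a * b) = φ a * φ b := by
    intro a b
    have hab : (e a, e b, e (a * b)) ∈
        Set.range fun a : Y × Y => (e' a.1, e' a.2, e' (a.1 * a.2)) :=
      hmul ▸ Set.mem_range_self (a, b)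
    obtain ⟨⟨c, d⟩, hcd⟩ := hab
    simp only [Prod.mk.injEq, ← hφ] at hcd
    rw [← he' hcd.1, ← he' hcd.2.1, he' hcd.2.2]
  have φstar : ∀ a, φ (star a) = star (φ a) := by
    intro a
    have ha : (e a, e (star a)) ∈ Set.range fun a : Y => (e' a, e' (star a)) :=
      hstar ▸ Set.mem_range_self a
    obtain ⟨c, hc⟩ := ha
    simp only [Prod.mk.injEq, ← hφ] at hc
    rw [← he' hc.1, he' hc.2]
  have φsmul : ∀ (r : ℂ) a, φ (r • a) = r • φ a := by
    intro r a
    have ha : (r, e a, e (r • a)) ∈ Set.range fun a : ℂ × Y => (a.1, e' a.2, e' (a.1 • a.2)) :=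
      hsmul ▸ Set.mem_range_self (r, a)
    obtain ⟨⟨s, c⟩, hc⟩ := ha
    simp only [Prod.mk.injEq, ← hφ] at hc
    rw [← he' hc.2.1, ← he' hc.2.2, hc.1]
  have φg : ∀ w, φ (g w) = g' w := by
    intro w
    have hw : (w, e (g w)) ∈ Set.range fun w : W => (w, e' (g' w)) :=
      hg ▸ Set.mem_range_self w
    obtain ⟨v, hv⟩ := hw
    simp only [Prod.mk.injEq, ← hφ] at hv
    rw [← hv.1, he' hv.2, hv.1]
  have φone : φ 1 = 1 := by simpa using φg 1
  refine ⟨{ toFun := φ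
            map_one' := φone
            map_mul' := φmul
            map_zero' := by simpa using φsmul 0 0
            map_add' := φadd
            commutes' := fun r => by
              rw [Algebra.algebraMap_eq_smul_one, Algebra.algebraMap_eq_smul_one, φsmul, φone]
            map_star' := φstar }, ?_⟩
  ext w
  exact (φg w).symm

end Code

/-- There is a small family of homomorphisms from `W` to nontrivial C*-algebras of real rank zero
through which every homomorphism to a nontrivial separable C*-algebra of real rank zero factors. -/
theorem exists_small_rr0_family (W : Type) [CStarAlgebra W] :
    ∃ (I : Type) (A : I → Type) (_ : ∀ i, Nontrivial (A i)) (_ : ∀ i, CStarAlgebra (A i))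
      (g : ∀ i, W →⋆ₐ[ℂ] A i), (∀ i, RealRankZero (A i)) ∧
      ∀ (X : Type) (_ : Nontrivial X) (_ : CStarAlgebra X),
        TopologicalSpace.SeparableSpace X → RealRankZero X →
          ∀ f : W →⋆ₐ[ℂ] X, ∃ (i : I) (φ : A i →⋆ₐ[ℂ] X), f = φ.comp (g i) := by
  let K : Type := lp (fun _ : ℕ => ℝ) ∞
  let I : Type := {c : CStarCode W K // ∃ (X : Type) (_ : Nontrivial X) (_ : CStarAlgebra X)
    (f : W →⋆ₐ[ℂ] X) (e : X → K), RealRankZero X ∧ cstarCode f e = c}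
  choose A hnt hcs g e hrr hcode using fun i : I => i.2
  refine ⟨I, A, hnt, hcs, g, hrr, ?_⟩
  intro X _ _ _ hX f
  let i : I := ⟨cstarCode f (kuratowskiEmbedding X), X, ‹_›, ‹_›, f, _, hX, rfl⟩
  exact ⟨i, exists_comp_eq_of_cstarCode_eq (kuratowskiEmbedding.isometry X).injective (hcode i)⟩

/-- The unital star homomorphism to a trivial C*-algebra. -/
def StarAlgHom.toSubsingleton (Z X : Type*) [CStarAlgebra Z] [CStarAlgebra X] [Subsingleton X] :
    Z →⋆ₐ[ℂ] X where
  toFun _ := 0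
  map_one' := Subsingleton.elim _ _
  map_mul' _ _ := Subsingleton.elim _ _
  map_zero' := rfl
  map_add' _ _ := Subsingleton.elim _ _
  commutes' _ := Subsingleton.elim _ _
  map_star' _ := Subsingleton.elim _ _

/-- For any separable unital C*-algebra `W` there exist a separable unital C*-algebra
`Z` of real rank zero and an `RR₀`-invertible unital *-homomorphism `p : W → Z`:
every unital *-homomorphism from `W` to a separable unital C*-algebra of real rank zero
factors through `p`. -/
theorem exists_rr0_invertible_hom (W : Type) [CStarAlgebra W]
    [TopologicalSpace.SeparableSpace W] :
    ∃ (Z : Type) (_ : CStarAlgebra Z), TopologicalSpace.SeparableSpace Z ∧ RealRankZero Z ∧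
      ∃ p : W →⋆ₐ[ℂ] Z,
        ∀ (X : Type) (_ : CStarAlgebra X), TopologicalSpace.SeparableSpace X → RealRankZero X →
          ∀ g : W →⋆ₐ[ℂ] X, ∃ h : Z →⋆ₐ[ℂ] X, g = h.comp p := by
  obtain ⟨I, A, _, _, g, hA, hfac⟩ := exists_small_rr0_family W
  let q : W →⋆ₐ[ℂ] lp A ∞ := lp.inftyLift g
  obtain ⟨D, hDc, hDd⟩ := TopologicalSpace.exists_countable_dense W
  obtain ⟨Z, hZclosed, hDZ, hZsep, hZ⟩ :=
    (RealRankZero.lp_infty hA).exists_separable_starSubalgebra (hDc.image q)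
  have hqcont : Continuous q :=
    AddMonoidHomClass.continuous_of_bound q 1 fun w => by
      simpa using NonUnitalStarAlgHom.norm_apply_le q w
  have hqZ : ∀ w, q w ∈ Z := fun w =>
    hZclosed.closure_subset (map_mem_closure hqcont (hDd w) fun d hd =>
      hDZ (Set.mem_image_of_mem q hd))
  have := hZclosed
  refine ⟨Z, StarSubalgebra.cstarAlgebra Z, hZsep, hZ, q.codRestrict Z hqZ, ?_⟩
  intro X _ hXsep hX f
  rcases subsingleton_or_nontrivial X with _ | _
  · exact ⟨StarAlgHom.toSubsingleton Z X, StarAlgHom.ext fun _ => Subsingleton.elim _ _⟩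
  · obtain ⟨i, φ, rfl⟩ := hfac X ‹_› _ hXsep hX f
    exact ⟨(φ.comp (lp.inftyEval A i)).comp Z.subtype, rfl⟩
end

section
/- Let X be a unital C*-algebra of real rank zero and let Y ⊆ X be a dense subset. Let exp_ω Y denote the partially ordered set of all countable subsets of Y, ordered by inclusion. Then the set A' = {α ∈ exp_ω Y : the topological closure of the unital star-subalgebra of X generated by α is a separable unital C*-algebra of real rank zero} is cofinal and ω-closed in exp_ω Y; here a countable chain in exp_ω Y has its union as least upper bound. -/
open TopologicalSpace in
theorem StarAlgebra.isSeparable_adjoin {X : Type*} [CStarAlgebra X] {s : Set X}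
    (hs : s.Countable) : IsSeparable (StarAlgebra.adjoin ℂ s : Set X) := by
  have hc : (Submonoid.closure (s ∪ star s) : Set X).Countable := by
    have : Countable ↥(s ∪ star s) :=
      (hs.union (by simpa using hs.preimage star_injective)).to_subtype
    have : Countable (FreeMonoid ↥(s ∪ star s)) := inferInstanceAs (Countable (List _))
    rw [Submonoid.closure_eq_mrange, MonoidHom.coe_mrange]
    exact Set.countable_range _
  have h := hc.isSeparable.span (R := ℂ)
  rwa [← StarAlgebra.adjoin_eq_span] at h

theorem StarAlgebra.separableSpace_topologicalClosure_adjoin {X : Type*} [CStarAlgebra X]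
    {s : Set X} (hs : s.Countable) :
    TopologicalSpace.SeparableSpace
      ((StarAlgebra.adjoin ℂ s).topologicalClosure : StarSubalgebra ℂ X) :=
  (StarAlgebra.isSeparable_adjoin hs).closure.separableSpace

theorem StarAlgebra.coe_adjoin_iUnion_of_directed {X : Type*} [CStarAlgebra X] {ι : Type*}
    [Nonempty ι] {s : ι → Set X} (hs : Directed (· ⊆ ·) s) :
    (StarAlgebra.adjoin ℂ (⋃ i, s i) : Set X) = ⋃ i, (StarAlgebra.adjoin ℂ (s i) : Set X) := by
  have h : StarAlgebra.adjoin ℂ (⋃ i, s i) = ⨆ i, StarAlgebra.adjoin ℂ (s i) :=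
    StarAlgebra.gc.l_iSup
  rw [h, StarSubalgebra.coe_iSup_of_directed]
  exact hs.mono_comp _ fun _ _ h => StarAlgebra.adjoin_mono h

open ComplexStarModule in
theorem norm_sub_realPart_le_of_isSelfAdjoint {X : Type*} [CStarAlgebra X] {x : X}
    (hx : IsSelfAdjoint x) (d : X) : ‖x - (ℜ d : X)‖ ≤ ‖x - d‖ := by
  have h : x - (ℜ d : X) = (ℜ (x - d) : X) := by
    rw [map_sub, AddSubgroup.coe_sub, hx.coe_realPart]
  rw [h]
  exact realPart.norm_le (x - d)

open ComplexStarModule in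
theorem StarSubalgebra.realPart_mem {X : Type*} [CStarAlgebra X] (S : StarSubalgebra ℂ X)
    {d : X} (hd : d ∈ S) : (ℜ d : X) ∈ S := by
  rw [realPart_apply_coe, ← Complex.coe_smul]
  exact S.smul_mem (add_mem hd (star_mem hd)) _

theorem StarSubalgebra.realRankZero_iff {X : Type*} [CStarAlgebra X] {S : StarSubalgebra ℂ X}
    (hS : IsClosed (S : Set X)) :
    RealRankZero S ↔ ∀ x ∈ S, IsSelfAdjoint x → ∀ ε : ℝ, 0 < ε →
      ∃ y ∈ S, IsSelfAdjoint y ∧ IsUnit y ∧ ‖x - y‖ < ε := by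
  have : IsClosed (S : Set X) := hS
  constructor
  · intro h x hxS hx ε hε
    obtain ⟨y, hy, hu, hxy⟩ := h ⟨x, hxS⟩ (Subtype.ext hx) ε hε
    exact ⟨y, y.2, congrArg Subtype.val hy, S.coe_isUnit.2 hu, hxy⟩
  · intro h x hx ε hε
    obtain ⟨y, hyS, hy, hu, hxy⟩ := h x x.2 (congrArg Subtype.val hx) ε hε
    exact ⟨⟨y, hyS⟩, Subtype.ext hy, S.coe_isUnit.1 hu, hxy⟩

open ComplexStarModule in
theorem StarSubalgebra.realRankZero_of_subset_closure {X : Type*} [CStarAlgebra X]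
    {S : StarSubalgebra ℂ X} (hS : IsClosed (S : Set X)) {D : Set X}
    (hD : (S : Set X) ⊆ closure D)
    (h : ∀ d ∈ D, ∀ ε : ℝ, 0 < ε →
      ∃ y ∈ S, IsSelfAdjoint y ∧ IsUnit y ∧ ‖(ℜ d : X) - y‖ < ε) :
    RealRankZero S := by
  rw [StarSubalgebra.realRankZero_iff hS]
  intro x hxS hx ε hε
  obtain ⟨d, hd, hxd⟩ := Metric.mem_closure_iff.1 (hD hxS) (ε / 2) (half_pos hε)
  obtain ⟨y, hyS, hy, hu, hdy⟩ := h d hd (ε / 2) (half_pos hε)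
  refine ⟨y, hyS, hy, hu, ?_⟩
  rw [dist_eq_norm] at hxd
  linarith [norm_sub_realPart_le_of_isSelfAdjoint hx d,
    norm_sub_le_norm_sub_add_norm_sub x (ℜ d : X) y]

open ComplexStarModule in
theorem RealRankZero.topologicalClosure_adjoin_iUnion {X : Type*} [CStarAlgebra X] {ι : Type*}
    [Nonempty ι] {s : ι → Set X} (hs : Directed (· ⊆ ·) s)
    (h : ∀ i, ∀ d ∈ StarAlgebra.adjoin ℂ (s i), ∀ ε : ℝ, 0 < ε →
      ∃ y ∈ (StarAlgebra.adjoin ℂ (⋃ i, s i)).topologicalClosure,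
        IsSelfAdjoint y ∧ IsUnit y ∧ ‖(ℜ d : X) - y‖ < ε) :
    RealRankZero ((StarAlgebra.adjoin ℂ (⋃ i, s i)).topologicalClosure : StarSubalgebra ℂ X) := by
  refine StarSubalgebra.realRankZero_of_subset_closure
    (StarSubalgebra.isClosed_topologicalClosure _)
    (StarSubalgebra.topologicalClosure_coe _).subset fun d hd => ?_
  rw [StarAlgebra.coe_adjoin_iUnion_of_directed hs] at hd
  obtain ⟨i, hi⟩ := Set.mem_iUnion.1 hd
  exact h i d hi

theorem realRankZero_topologicalClosure_adjoin_empty (X : Type*) [CStarAlgebra X] :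
    RealRankZero ((StarAlgebra.adjoin ℂ (∅ : Set X)).topologicalClosure :
      StarSubalgebra ℂ X) := by
  set S := (StarAlgebra.adjoin ℂ (∅ : Set X)).topologicalClosure
  refine StarSubalgebra.realRankZero_of_subset_closure
    (StarSubalgebra.isClosed_topologicalClosure _)
    (StarSubalgebra.topologicalClosure_coe _).subset fun d hd ε hε => ?_
  have hbot : StarAlgebra.adjoin ℂ (∅ : Set X) = ⊥ := StarAlgebra.gc.l_bot
  rw [hbot, SetLike.mem_coe, StarSubalgebra.mem_bot] at hd
  obtain ⟨c, rfl⟩ := hd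
  obtain ⟨t, ht0, ht⟩ : ∃ t : ℝ, t ≠ 0 ∧ |c.re - t| * ‖(1 : X)‖ < ε := by
    have hcont : Filter.Tendsto (fun t : ℝ => |c.re - t| * ‖(1 : X)‖) (nhdsWithin c.re {c.re}ᶜ)
        (nhds (|c.re - c.re| * ‖(1 : X)‖)) :=
      (Continuous.tendsto (by fun_prop) c.re).mono_left nhdsWithin_le_nhds
    by_cases hc : c.re = 0
    · have h1 := hcont.eventually_lt_const (u := ε) (by simpa using hε)
      obtain ⟨t, ht, htc⟩ := (h1.and self_mem_nhdsWithin).exists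
      exact ⟨t, by simpa [hc] using htc, ht⟩
    · exact ⟨c.re, hc, by simpa using hε⟩
  refine ⟨algebraMap ℂ X t, S.algebraMap_mem _, ?_, ?_, ?_⟩
  · exact IsSelfAdjoint.algebraMap X (Complex.conj_ofReal t)
  · exact (IsUnit.mk0 (t : ℂ) (by exact_mod_cast ht0)).map (algebraMap ℂ X)
  · have hr : ((realPart (algebraMap ℂ X c) : selfAdjoint X) : X) = algebraMap ℂ X (c.re : ℂ) := by
      rw [realPart_apply_coe, ← algebraMap_star_comm, ← map_add, ← Complex.coe_smul,
        Algebra.smul_def, ← map_mul]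
      congr 1
      have := Complex.add_conj c
      rw [Complex.star_def, this]
      push_cast
      ring
    rw [hr, ← map_sub, ← Complex.ofReal_sub, norm_algebraMap, Complex.norm_real, Real.norm_eq_abs]
    exact ht

theorem Dense.exists_countable_subset_mem_closure {X : Type*} [PseudoMetricSpace X] {Y : Set X}
    (hY : Dense Y) (z : X) : ∃ t ⊆ Y, t.Countable ∧ z ∈ closure t := by
  obtain ⟨u, hu, hz⟩ := mem_closure_iff_seq_limit.1 (hY z)
  exact ⟨Set.range u, Set.range_subset_iff.2 hu, Set.countable_range u,
    mem_closure_of_tendsto hz (.of_forall fun n => Set.mem_range_self n)⟩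

open ComplexStarModule in
theorem RealRankZero.exists_countable_superset {X : Type*} [CStarAlgebra X]
    (hX : RealRankZero X) {Y : Set X} (hY : Dense Y) {a : Set X} (haY : a ⊆ Y)
    (ha : a.Countable) :
    ∃ b, a ⊆ b ∧ b ⊆ Y ∧ b.Countable ∧ ∀ d ∈ StarAlgebra.adjoin ℂ a, ∀ ε : ℝ, 0 < ε →
      ∃ y ∈ closure b, IsSelfAdjoint y ∧ IsUnit y ∧ ‖(ℜ d : X) - y‖ < ε := by
  obtain ⟨E, hEc, hE⟩ := StarAlgebra.isSeparable_adjoin ha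
  choose y hy hu hey using fun (e : X) (n : ℕ) =>
    hX (ℜ e : X) (ℜ e).2 (1 / ((n : ℝ) + 1)) Nat.one_div_pos_of_nat
  choose t htY htc hzt using hY.exists_countable_subset_mem_closure
  refine ⟨a ∪ ⋃ e ∈ E, ⋃ n, t (y e n), Set.subset_union_left, ?_, ?_, ?_⟩
  · simp only [Set.union_subset_iff, Set.iUnion_subset_iff]
    exact ⟨haY, fun e _ n => htY _⟩
  · exact ha.union (hEc.biUnion fun e _ => Set.countable_iUnion fun n => htc _)
  · intro d hd ε hε
    obtain ⟨e, he, hde⟩ := Metric.mem_closure_iff.1 (hE hd) (ε / 2) (half_pos hε)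
    obtain ⟨n, hn⟩ := exists_nat_one_div_lt (half_pos hε)
    refine ⟨y e n, closure_mono ?_ (hzt (y e n)), hy e n, hu e n, ?_⟩
    · exact ((Set.subset_iUnion (fun n => t (y e n)) n).trans
        (Set.subset_biUnion_of_mem (u := fun e => ⋃ n, t (y e n)) he)).trans
        Set.subset_union_right
    · have h1 : ‖(ℜ d : X) - (ℜ e : X)‖ ≤ ‖d - e‖ := by
        rw [← AddSubgroup.coe_sub, ← map_sub]
        exact realPart.norm_le (d - e)
      rw [dist_eq_norm] at hde
      linarith [hey e n, norm_sub_le_norm_sub_add_norm_sub (ℜ d : X) (ℜ e : X) (y e n)]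

theorem RealRankZero.exists_countable_superset_realRankZero {X : Type*} [CStarAlgebra X]
    (hX : RealRankZero X) {Y : Set X} (hY : Dense Y) {a : Set X} (haY : a ⊆ Y)
    (ha : a.Countable) :
    ∃ b, a ⊆ b ∧ b ⊆ Y ∧ b.Countable ∧
      RealRankZero ((StarAlgebra.adjoin ℂ b).topologicalClosure : StarSubalgebra ℂ X) := by
  choose f hf hfY hfc hfr using fun c : {α : Set X // α ⊆ Y ∧ α.Countable} =>
    hX.exists_countable_superset hY c.2.1 c.2.2
  let s : ℕ → {α : Set X // α ⊆ Y ∧ α.Countable} :=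
    fun n => (fun c => ⟨f c, hfY c, hfc c⟩)^[n] ⟨a, haY, ha⟩
  have hs (n : ℕ) : (s (n + 1)).1 = f (s n) := by
    simp only [s, Function.iterate_succ_apply']
  have hmono : Monotone fun n => (s n).1 :=
    monotone_nat_of_le_succ fun n => (hf (s n)).trans (hs n).symm.subset
  refine ⟨⋃ n, (s n).1, Set.subset_iUnion (fun n => (s n).1) 0,
    Set.iUnion_subset fun n => (s n).2.1, Set.countable_iUnion fun n => (s n).2.2,
    RealRankZero.topologicalClosure_adjoin_iUnion hmono.directed_le fun n d hd ε hε => ?_⟩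
  obtain ⟨y, hyb, hy⟩ := hfr (s n) d hd ε hε
  refine ⟨y, closure_mono ?_ hyb, hy⟩
  rw [← hs n]
  exact (Set.subset_iUnion (fun n => (s n).1) (n + 1)).trans (StarAlgebra.subset_adjoin ℂ _)

theorem RealRankZero.topologicalClosure_adjoin_iUnion_of_directed {X : Type*} [CStarAlgebra X]
    {ι : Type*} {s : ι → Set X} (hs : Directed (· ⊆ ·) s)
    (h : ∀ i, RealRankZero
      ((StarAlgebra.adjoin ℂ (s i)).topologicalClosure : StarSubalgebra ℂ X)) :
    RealRankZero ((StarAlgebra.adjoin ℂ (⋃ i, s i)).topologicalClosure : StarSubalgebra ℂ X) := by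
  cases isEmpty_or_nonempty ι
  · rw [Set.iUnion_of_empty]
    exact realRankZero_topologicalClosure_adjoin_empty X
  refine RealRankZero.topologicalClosure_adjoin_iUnion hs fun i d hd ε hε => ?_
  obtain ⟨y, hyS, hy⟩ := (StarSubalgebra.realRankZero_iff
    (StarSubalgebra.isClosed_topologicalClosure _)).1 (h i) _
    (StarSubalgebra.realPart_mem _ (StarSubalgebra.le_topologicalClosure _ hd))
    (realPart d).2 ε hε
  exact ⟨y, StarSubalgebra.topologicalClosure_mono
    (StarAlgebra.adjoin_mono (Set.subset_iUnion s i)) hyS, hy⟩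

theorem Set.eq_iUnion_of_isLUB_countable_subsets {X : Type*} {Y : Set X}
    {C : Set {α : Set X // α ⊆ Y ∧ α.Countable}} (hC : C.Countable)
    {s : {α : Set X // α ⊆ Y ∧ α.Countable}} (hs : IsLUB C s) : s.1 = ⋃ c : C, c.1.1 := by
  have : Countable C := hC.to_subtype
  refine Set.Subset.antisymm ?_ (Set.iUnion_subset fun c => hs.1 c.2)
  let u : {α : Set X // α ⊆ Y ∧ α.Countable} :=
    ⟨⋃ c : C, c.1.1, Set.iUnion_subset fun c => c.1.2.1,
      Set.countable_iUnion fun c => c.1.2.2⟩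
  have hu : u ∈ upperBounds C := fun c hc =>
    Set.subset_iUnion (fun c : C => c.1.1) ⟨c, hc⟩
  exact hs.2 hu

theorem cofinal_omegaClosed_separable_realRankZero_subalgebras
    (X : Type*) [CStarAlgebra X] (hX : RealRankZero X)
    (Y : Set X) (hY : Dense Y) :
    -- `expω` is the partially ordered set of all countable subsets of `Y`,
    -- ordered by inclusion.
    let expω := {α : Set X // α ⊆ Y ∧ α.Countable}
    let A' : Set expω :=
      {α : expω |
        TopologicalSpace.SeparableSpace
          ((StarAlgebra.adjoin ℂ α.1).topologicalClosure : StarSubalgebra ℂ X) ∧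
        RealRankZero ((StarAlgebra.adjoin ℂ α.1).topologicalClosure : StarSubalgebra ℂ X)}
    -- `A'` is cofinal in `expω` ...
    (∀ a : expω, ∃ b ∈ A', a ≤ b) ∧
    -- ... and `ω`-closed in `expω`.
    (∀ C : Set expω, C ⊆ A' → IsChain (· ≤ ·) C → C.Countable →
      ∀ s : expω, IsLUB C s → s ∈ A') := by
  intro expω A'
  refine ⟨fun a => ?_, fun C hCA hC hCc s hs => ?_⟩
  · obtain ⟨b, hab, hbY, hbc, hb⟩ := hX.exists_countable_superset_realRankZero hY a.2.1 a.2.2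
    exact ⟨⟨b, hbY, hbc⟩,
      ⟨StarAlgebra.separableSpace_topologicalClosure_adjoin hbc, hb⟩, hab⟩
  · refine ⟨StarAlgebra.separableSpace_topologicalClosure_adjoin s.2.2, ?_⟩
    rw [Set.eq_iUnion_of_isLUB_countable_subsets hCc hs]
    exact RealRankZero.topologicalClosure_adjoin_iUnion_of_directed
      (s := fun c : C => c.1.1) hC.directed fun c => (hCA c.2).2
end
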